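/- Let a and b be elements of a commutative ring of characteristic 2. With u_n = ⟨W_n⟩, v_n = ⟨W_n'⟩, X_n = A·u_n^4 + B·u_n^3·v_n + C·u_n^2·v_n^2 + v_n^4 where A = ab + b^2 + 1, B = ab(a+b), C = ab, we have for all n ≥ 1: X_n + 1 = ε_{n−1}·u_n^2·(a + b), where ε_m = a if m is even and ε_m = b if m is odd. -/

import Mathlib

/-- The continuant `⟨W⟩` of a finite word `W` with letters in a commutative ring,
defined by `⟨∅⟩ = 1`, `⟨w⟩ = w` and `⟨W⟩ = w₁⟨W'⟩ + ⟨(W')'⟩`, where `W'` is `W`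
with its first letter deleted. -/
def continuant {R : Type*} [CommRing R] : List R → R
  | [] => 1
  | [x] => x
  | x :: y :: l => x * continuant (y :: l) + continuant l

/-- The morphism `σ` with `σ(a) = ab`, `σ(b) = aa`, on the abstract two-letter
alphabet `Bool` (where `false` stands for `a` and `true` for `b`), extended to
words by concatenation. -/
def pdStep (l : List Bool) : List Bool :=
  l.flatMap fun x => bif x then [false, false] else [false, true]

/-- The abstract word `Wₙ = (σⁿ(a))''`: the word `σⁿ(a)` with its last letter
removed. -/
def pdWordBool (n : ℕ) : List Bool := (pdStep^[n] [false]).dropLast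

/-- The word `Wₙ = (σⁿ(a))''` with letters the elements `a`, `b` of a ring. -/
def pdWord {R : Type*} (a b : R) (n : ℕ) : List R :=
  (pdWordBool n).map fun x => bif x then b else a

/-- The product of the matrices `!![x, 1; 1, 0]` over the letters `x` of a word. -/
def continuantMatrix {R : Type*} [CommRing R] (l : List R) : Matrix (Fin 2) (Fin 2) R :=
  (l.map fun x => !![x, 1; 1, 0]).prod

theorem continuantMatrix_append {R : Type*} [CommRing R] (l₁ l₂ : List R) :
    continuantMatrix (l₁ ++ l₂) = continuantMatrix l₁ * continuantMatrix l₂ := by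
  simp [continuantMatrix]

theorem continuantMatrix_cons {R : Type*} [CommRing R] (x : R) (l : List R) :
    continuantMatrix (x :: l) = !![x, 1; 1, 0] * continuantMatrix l := by
  simp [continuantMatrix]

theorem continuantMatrix_cons_one_zero {R : Type*} [CommRing R] (x : R) (l : List R) :
    continuantMatrix (x :: l) 1 0 = continuantMatrix l 0 0 := by
  simp [continuantMatrix_cons, Matrix.mul_apply]

theorem continuantMatrix_zero_zero {R : Type*} [CommRing R] (l : List R) :
    continuantMatrix l 0 0 = continuant l := by
  induction l using continuant.induct with
  | case1 => simp [continuantMatrix, continuant]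
  | case2 x => simp [continuantMatrix, continuant]
  | case3 x y l ih₁ ih₂ =>
    rw [continuant, ← ih₁, ← ih₂, ← continuantMatrix_cons_one_zero y l,
      continuantMatrix_cons x]
    simp [Matrix.mul_apply]

theorem continuantMatrix_one_zero {R : Type*} [CommRing R] {l : List R} (hl : l ≠ []) :
    continuantMatrix l 1 0 = continuant l.tail := by
  obtain ⟨x, l, rfl⟩ := List.exists_cons_of_ne_nil hl
  rw [continuantMatrix_cons_one_zero, continuantMatrix_zero_zero, List.tail_cons]

theorem continuantMatrix_det {R : Type*} [CommRing R] [CharP R 2] (l : List R) :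
    (continuantMatrix l).det = 1 := by
  induction l with
  | nil => simp [continuantMatrix]
  | cons x l ih =>
    rw [continuantMatrix_cons, Matrix.det_mul, ih]
    simp [Matrix.det_fin_two, CharTwo.neg_eq]

theorem pdStep_iterate_append (n : ℕ) (l₁ l₂ : List Bool) :
    pdStep^[n] (l₁ ++ l₂) = pdStep^[n] l₁ ++ pdStep^[n] l₂ := by
  induction n generalizing l₁ l₂ with
  | zero => rfl
  | succ n ih =>
    have h : pdStep (l₁ ++ l₂) = pdStep l₁ ++ pdStep l₂ := List.flatMap_append
    simp only [Function.iterate_succ_apply, h, ih]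

theorem pdStep_iterate_succ_false (n : ℕ) :
    pdStep^[n + 1] [false] = pdStep^[n] [false] ++ pdStep^[n] [true] := by
  rw [Function.iterate_succ_apply, ← pdStep_iterate_append]
  rfl

theorem pdStep_iterate_succ_true (n : ℕ) :
    pdStep^[n + 1] [true] = pdStep^[n] [false] ++ pdStep^[n] [false] := by
  rw [Function.iterate_succ_apply, ← pdStep_iterate_append]
  rfl

/-- The words `σⁿ(a)` and `σⁿ(b)` differ exactly in their last letter. -/
theorem pdStep_iterate_eq (n : ℕ) :
    pdStep^[n] [false] = pdWordBool n ++ [!decide (Even n)] ∧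
      pdStep^[n] [true] = pdWordBool n ++ [decide (Even n)] := by
  induction n with
  | zero => simp [pdWordBool]
  | succ n ih =>
    rw [pdWordBool, pdStep_iterate_succ_false, pdStep_iterate_succ_true, ih.1, ih.2,
      ← List.append_assoc, List.dropLast_concat]
    by_cases h : Even n <;> simp [Nat.even_add_one, h]

theorem pdWordBool_succ (n : ℕ) :
    pdWordBool (n + 1) = pdWordBool n ++ (!decide (Even n)) :: pdWordBool n := by
  rw [pdWordBool, pdStep_iterate_succ_false, (pdStep_iterate_eq n).1, (pdStep_iterate_eq n).2,
    ← List.append_assoc, List.dropLast_concat]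
  simp

theorem pdWord_succ {R : Type*} (a b : R) (n : ℕ) :
    pdWord a b (n + 1) = pdWord a b n ++ (if Even n then a else b) :: pdWord a b n := by
  by_cases h : Even n <;> simp [pdWord, pdWordBool_succ, h]

theorem continuantMatrix_pdWord_succ {R : Type*} [CommRing R] (a b : R) (n : ℕ) :
    continuantMatrix (pdWord a b (n + 1)) = continuantMatrix (pdWord a b n) *
      (!![if Even n then a else b, 1; 1, 0] * continuantMatrix (pdWord a b n)) := by
  rw [pdWord_succ, continuantMatrix_append, continuantMatrix_cons]

theorem continuantMatrix_pdWord_symm {R : Type*} [CommRing R] (a b : R) (n : ℕ) :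
    continuantMatrix (pdWord a b n) 0 1 = continuantMatrix (pdWord a b n) 1 0 := by
  induction n with
  | zero => simp [pdWord, pdWordBool, continuantMatrix]
  | succ n ih =>
    rw [continuantMatrix_pdWord_succ]
    simp only [Matrix.mul_apply, Fin.sum_univ_two, Matrix.of_apply, Matrix.cons_val',
      Matrix.cons_val_zero, Matrix.cons_val_one, Matrix.cons_val_fin_one, ih]
    ring

theorem continuantMatrix_pdWord_succ_zero_zero {R : Type*} [CommRing R] [CharP R 2]
    (a b : R) (n : ℕ) :
    continuantMatrix (pdWord a b (n + 1)) 0 0 =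
      (if Even n then a else b) * continuantMatrix (pdWord a b n) 0 0 ^ 2 := by
  rw [continuantMatrix_pdWord_succ]
  simp only [Matrix.mul_apply, Fin.sum_univ_two, Matrix.of_apply, Matrix.cons_val',
    Matrix.cons_val_zero, Matrix.cons_val_one, Matrix.cons_val_fin_one,
    continuantMatrix_pdWord_symm]
  linear_combination continuantMatrix (pdWord a b n) 0 0 * continuantMatrix (pdWord a b n) 1 0 *
    CharTwo.two_eq_zero (R := R)

theorem continuantMatrix_pdWord_succ_one_zero {R : Type*} [CommRing R] [CharP R 2]
    (a b : R) (n : ℕ) :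
    continuantMatrix (pdWord a b (n + 1)) 1 0 = (if Even n then a else b) *
      continuantMatrix (pdWord a b n) 0 0 * continuantMatrix (pdWord a b n) 1 0 + 1 := by
  have hdet := continuantMatrix_det (pdWord a b n)
  rw [Matrix.det_fin_two, continuantMatrix_pdWord_symm] at hdet
  rw [continuantMatrix_pdWord_succ]
  simp only [Matrix.mul_apply, Fin.sum_univ_two, Matrix.of_apply, Matrix.cons_val',
    Matrix.cons_val_zero, Matrix.cons_val_one, Matrix.cons_val_fin_one]
  linear_combination hdet + continuantMatrix (pdWord a b n) 1 0 ^ 2 *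
    CharTwo.two_eq_zero (R := R)

theorem pdWord_succ_ne_nil {R : Type*} (a b : R) (n : ℕ) : pdWord a b (n + 1) ≠ [] := by
  simp [pdWord_succ]

/-- Let `a`, `b` be elements of a commutative ring of characteristic 2.  With
`uₙ = ⟨Wₙ⟩`, `vₙ = ⟨Wₙ'⟩` and `Xₙ = A·uₙ⁴ + B·uₙ³·vₙ + C·uₙ²·vₙ² + vₙ⁴`, where
`A = ab + b² + 1`, `B = ab(a+b)`, `C = ab`, we have for all `n ≥ 1`:
`Xₙ + 1 = ε_{n−1}·uₙ²·(a+b)`, where `εₘ = a` if `m` is even and `εₘ = b` if `m`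
is odd. -/
theorem pd_X_closed_form
    {R : Type*} [CommRing R] [CharP R 2] (a b : R)
    (u v X : ℕ → R)
    (hu : ∀ n, u n = continuant (pdWord a b n))
    (hv : ∀ n, v n = continuant (pdWord a b n).tail)
    (hX : ∀ n, X n = (a * b + b ^ 2 + 1) * u n ^ 4 + (a * b * (a + b)) * u n ^ 3 * v n
      + (a * b) * u n ^ 2 * v n ^ 2 + v n ^ 4) :
    ∀ n : ℕ, 1 ≤ n →
      X n + 1 = (if Even (n - 1) then a else b) * u n ^ 2 * (a + b) := by
  have h2 : (2 : R) = 0 := CharTwo.two_eq_zero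
  have hu' (n : ℕ) : u (n + 1) = (if Even n then a else b) * u n ^ 2 := by
    rw [hu, hu, ← continuantMatrix_zero_zero, ← continuantMatrix_zero_zero,
      continuantMatrix_pdWord_succ_zero_zero]
  have hv' (n : ℕ) :
      v (n + 2) = (if Even (n + 1) then a else b) * u (n + 1) * v (n + 1) + 1 := by
    rw [hu, hv, hv, ← continuantMatrix_one_zero (pdWord_succ_ne_nil a b (n + 1)),
      ← continuantMatrix_one_zero (pdWord_succ_ne_nil a b n), ← continuantMatrix_zero_zero,
      continuantMatrix_pdWord_succ_one_zero]
  intro n hn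
  induction n, hn using Nat.le_induction with
  | base =>
    have hu1 : u 1 = a := by simp [hu, pdWord, pdWordBool, pdStep, continuant]
    have hv1 : v 1 = 1 := by simp [hv, pdWord, pdWordBool, pdStep, continuant]
    simp only [hX, hu1, hv1, Nat.sub_self, Even.zero, if_true]
    linear_combination (a ^ 5 * b + a ^ 4 * b ^ 2 + 1) * h2
  | succ n hn ih =>
    obtain ⟨m, rfl⟩ := Nat.exists_eq_add_of_le' hn
    rw [hX] at ih ⊢
    rw [hu' (m + 1), hv' m]
    simp only [Nat.add_sub_cancel] at ih ⊢
    generalize u (m + 1) = p at ih ⊢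
    generalize v (m + 1) = q at ih ⊢
    by_cases h : Even m
    · simp only [h, Nat.even_add_one, not_true_eq_false, if_true, if_false] at ih ⊢
      grind
    · simp only [h, Nat.even_add_one, not_false_eq_true, if_true, if_false] at ih ⊢
      grind
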